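/- arXiv:1306.6386 — 2 statements merged into one kernel-verified Lean document; each statement's English description precedes it below -/
import Mathlib

section
/- For dimension d=2, α>2, and n≥1, there is a constant C (depending only on α) such that for every x∈ℝ², ∫_{ℝ²} (1 ∧ |√n(x−y)|^{-α})·|log|y|| dy ≤ C·( 1/n + |log|x||/n + (log n)/n · 1_{|x|<2/√n} ). -/
open MeasureTheory Real

lemma aux_kernel (α z : ℝ) (hα : 0 < α) (hz : 0 ≤ z) :
    min 1 (z ^ (-α)) ≤ 2 ^ α * (1 + z) ^ (-α) := by
  have h1 : (2:ℝ) ^ α * (1 + z) ^ (-α) = ((1 + z) / 2) ^ (-α) := by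
    rw [Real.div_rpow (by positivity) (by norm_num), Real.rpow_neg (by norm_num : (0:ℝ) ≤ 2)]
    field_simp
  rw [h1]
  rcases le_total z 1 with h | h
  · refine (min_le_left _ _).trans ?_
    exact Real.one_le_rpow_of_pos_of_le_one_of_nonpos (by positivity) (by linarith) (by linarith)
  · refine (min_le_right _ _).trans ?_
    exact Real.rpow_le_rpow_of_nonpos (by positivity) (by linarith) (by linarith)

lemma aux_log (β t : ℝ) (hβ : 0 < β) (ht : 0 < t) :
    |Real.log t| ≤ (t ^ β + t ^ (-β)) / β := by
  have h1 := Real.log_le_rpow_div ht.le hβ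
  have h2 := Real.log_le_rpow_div (inv_pos.2 ht).le hβ
  rw [Real.log_inv, Real.inv_rpow ht.le, ← Real.rpow_neg ht.le] at h2
  have h3 : 0 ≤ t ^ β / β := by positivity
  have h4 : 0 ≤ t ^ (-β) / β := by positivity
  rw [add_div, abs_le]
  constructor <;> linarith

lemma aux_big (β a b z : ℝ) (hβ : 0 < β) (hβ1 : β ≤ 1) (ha : 2 ≤ a) (hb : 0 < b) (hz : 0 ≤ z)
    (h1 : a ≤ b + z) (h2 : b ≤ a + z) :
    |Real.log b - Real.log a| ≤ 3 / β * ((1 + z ^ β) * (1 + b ^ (-β))) := by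
  have ha0 : 0 < a := by linarith
  rw [← Real.log_div hb.ne' ha0.ne']
  refine (aux_log β _ hβ (by positivity)).trans ?_
  have e1 : (b / a) ^ β ≤ 1 + z ^ β := by
    have : b / a ≤ 1 + z := by rw [div_le_iff₀ ha0]; nlinarith
    calc (b / a) ^ β ≤ (1 + z) ^ β := Real.rpow_le_rpow (by positivity) this hβ.le
      _ ≤ 1 ^ β + z ^ β := Real.rpow_add_le_add_rpow (by norm_num) hz hβ.le hβ1
      _ = _ := by simp
  have e2 : (b / a) ^ (-β) ≤ 1 + z ^ β * b ^ (-β) := by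
    have : a / b ≤ 1 + z / b := by rw [div_le_iff₀ hb]; field_simp; linarith
    calc (b / a) ^ (-β) = (a / b) ^ β := by
          rw [Real.rpow_neg (by positivity), ← Real.inv_rpow (by positivity), inv_div]
      _ ≤ (1 + z / b) ^ β := Real.rpow_le_rpow (by positivity) this hβ.le
      _ ≤ 1 ^ β + (z / b) ^ β := Real.rpow_add_le_add_rpow (by norm_num) (by positivity) hβ.le hβ1
      _ = _ := by rw [Real.div_rpow hz hb.le, Real.rpow_neg hb.le]; simp [div_eq_mul_inv]
  have e3 : 0 ≤ z ^ β := by positivity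
  have e4 : 0 ≤ b ^ (-β) := by positivity
  rw [div_mul_eq_mul_div]
  gcongr
  nlinarith [mul_nonneg e3 e4]

lemma aux_small (β a b z : ℝ) (hβ : 0 < β) (hβ1 : β ≤ 1) (ha : a ≤ 2) (hb : 0 < b) (hz : 0 ≤ z)
    (h2 : b ≤ a + z) :
    |Real.log b| ≤ 3 / β * ((1 + z ^ β) * (1 + b ^ (-β))) := by
  refine (aux_log β _ hβ hb).trans ?_
  have e1 : b ^ β ≤ 2 + z ^ β := by
    calc b ^ β ≤ (2 + z) ^ β := Real.rpow_le_rpow (by positivity) (by linarith) hβ.le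
      _ ≤ 2 ^ β + z ^ β := Real.rpow_add_le_add_rpow (by norm_num) hz hβ.le hβ1
      _ ≤ _ := by
        have := Real.rpow_le_rpow_of_exponent_le (by norm_num : (1:ℝ) ≤ 2) hβ1
        rw [Real.rpow_one] at this
        linarith
  have e3 : 0 ≤ z ^ β := by positivity
  have e4 : 0 ≤ b ^ (-β) := by positivity
  rw [div_mul_eq_mul_div]
  gcongr
  nlinarith [mul_nonneg e3 e4]

/-- combined bound -/
lemma aux_comb (α β b z L l : ℝ) (hβ : 0 < β) (hβα : β < α) (hb : 0 < b) (hz : 0 ≤ z)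
    (hL : 0 ≤ L) (h : l ≤ L + 3 / β * ((1 + z ^ β) * (1 + b ^ (-β)))) :
    min 1 (z ^ (-α)) * l ≤ 2 ^ α * (2 * (L + 6 / β) * (1 + z) ^ (-(α - β)) +
      6 / β * (if b < 1 then b ^ (-β) else 0)) := by
  have hk := aux_kernel α z (by linarith) hz
  have hk0 : 0 ≤ min 1 (z ^ (-α)) := by positivity
  have hb0 : 0 ≤ b ^ (-β) := by positivity
  have g0 : 0 ≤ (1 + z) ^ (-(α - β)) := by positivity
  have g1 : (1 + z) ^ (-(α - β)) ≤ 1 :=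
    Real.rpow_le_one_of_one_le_of_nonpos (by linarith) (by linarith)
  have e1 : (1 + z) ^ (-(α - β)) = (1 + z) ^ (-α) * (1 + z) ^ β := by
    rw [← Real.rpow_add (by linarith)]; ring_nf
  have hz1 : 1 + z ^ β ≤ 2 * (1 + z) ^ β := by
    have := Real.rpow_le_rpow hz (by linarith : z ≤ 1 + z) hβ.le
    have := Real.one_le_rpow (by linarith : 1 ≤ 1 + z) hβ.le
    linarith
  have hz0 : 0 ≤ z ^ β := by positivity
  have hα0 : 0 ≤ (1 + z) ^ (-α) := by positivity
  set g := (1 + z) ^ (-(α - β)) with hg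
  have h2 : (1 + z) ^ (-α) * (1 + z ^ β) ≤ 2 * g := by
    rw [e1]; nlinarith
  have h3 : g * (1 + b ^ (-β)) ≤ 2 * g + (if b < 1 then b ^ (-β) else 0) := by
    split_ifs with hb1
    · nlinarith
    · have : b ^ (-β) ≤ 1 := Real.rpow_le_one_of_one_le_of_nonpos (by linarith) (by linarith)
      nlinarith
  set H := (if b < 1 then b ^ (-β) else 0)
  calc min 1 (z ^ (-α)) * l
      ≤ min 1 (z ^ (-α)) * (L + 3 / β * ((1 + z ^ β) * (1 + b ^ (-β)))) := by gcongr
    _ ≤ (2 ^ α * (1 + z) ^ (-α)) * (L + 3 / β * ((1 + z ^ β) * (1 + b ^ (-β)))) := by gcongr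
    _ = 2 ^ α * (L * ((1 + z) ^ (-α)) +
          3 / β * (((1 + z) ^ (-α) * (1 + z ^ β)) * (1 + b ^ (-β)))) := by ring
    _ ≤ 2 ^ α * (L * (2 * g) + 3 / β * ((2 * g) * (1 + b ^ (-β)))) := by
        gcongr
        nlinarith
    _ = 2 ^ α * (L * (2 * g) + 6 / β * (g * (1 + b ^ (-β)))) := by ring
    _ ≤ 2 ^ α * (L * (2 * g) + 6 / β * (2 * g + H)) := by gcongr
    _ = _ := by ring

lemma aux_int (β : ℝ) (hβ1 : β ≤ 1) :
    Integrable (fun u : EuclideanSpace ℝ (Fin 2) => if ‖u‖ < 1 then ‖u‖ ^ (-β) else 0) := by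
  rw [integrable_fun_norm_addHaar volume (f := fun r : ℝ => if r < 1 then r ^ (-β) else 0)]
  have h : IntegrableOn (fun y : ℝ => y ^ (1 - β)) (Set.Ioo 0 1) := by
    rw [intervalIntegral.integrableOn_Ioo_rpow_iff one_pos]; linarith
  rw [← integrable_indicator_iff measurableSet_Ioo] at h
  refine (h.integrableOn (s := Set.Ioi 0)).congr_fun ?_ measurableSet_Ioi
  intro y hy
  have hy : 0 < y := hy
  by_cases h1 : y < 1
  · simp [h1, hy, sub_eq_add_neg, Real.rpow_add hy]
  · simp [h1]

theorem stmt1 (α : ℝ) (hα : 2 < α) :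
    ∃ C : ℝ, 0 < C ∧ ∀ n : ℝ, 1 ≤ n → ∀ x : EuclideanSpace ℝ (Fin 2),
      (∫ y : EuclideanSpace ℝ (Fin 2),
          min 1 ((Real.sqrt n * ‖x - y‖) ^ (-α)) * |Real.log ‖y‖|)
        ≤ C * (1 / n + |Real.log ‖x‖| / n
            + (if ‖x‖ < 2 / Real.sqrt n then Real.log n / n else 0)) := by
  obtain ⟨β, hβ, hβ1, hβα⟩ : ∃ β : ℝ, 0 < β ∧ β ≤ 1 ∧ 2 < α - β :=
    ⟨min 1 ((α - 2) / 2), lt_min one_pos (by linarith), min_le_left _ _, by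
      have := min_le_right 1 ((α - 2) / 2); linarith⟩
  set g : EuclideanSpace ℝ (Fin 2) → ℝ := fun u => (1 + ‖u‖) ^ (-(α - β)) with hg
  set H : EuclideanSpace ℝ (Fin 2) → ℝ := fun u => if ‖u‖ < 1 then ‖u‖ ^ (-β) else 0 with hH
  have hgi : Integrable g := integrable_one_add_norm (by simpa using hβα)
  have hHi : Integrable H := aux_int β hβ1
  have hg0 : ∀ u, 0 ≤ g u := fun u => by simp only [hg]; positivity
  have hH0 : ∀ u, 0 ≤ H u := fun u => by simp only [hH]; split_ifs <;> positivity
  have hG : 0 ≤ ∫ u, g u := integral_nonneg hg0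
  have hB : 0 ≤ ∫ u, H u := integral_nonneg hH0
  set G := ∫ u, g u
  set B := ∫ u, H u
  set D := 2 ^ α * (2 * G + 12 / β * G + 6 / β * B) with hD
  have hD0 : 0 ≤ D := by positivity
  refine ⟨D + 1, by linarith, ?_⟩
  intro n hn x
  have hn0 : 0 < n := by linarith
  set s := Real.sqrt n with hs
  have hs0 : 0 < s := Real.sqrt_pos.2 hn0
  have hs2 : s ^ 2 = n := Real.sq_sqrt hn0.le
  have hlogn : 0 ≤ Real.log n := Real.log_nonneg hn
  have hlogs : Real.log s = Real.log n / 2 := Real.log_sqrt hn0.le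
  have key : ∀ L : ℝ, 0 ≤ L →
      (∀ y : EuclideanSpace ℝ (Fin 2), y ≠ 0 → |Real.log ‖y‖| ≤ L + 3 / β *
        ((1 + (s * ‖x - y‖) ^ β) * (1 + (s * ‖y‖) ^ (-β)))) →
      (∫ y : EuclideanSpace ℝ (Fin 2), min 1 ((s * ‖x - y‖) ^ (-α)) * |Real.log ‖y‖|)
        ≤ D * ((1 + L) / n) := by
    intro L hL hy
    have i1 : Integrable (fun y => g (s • (x - y))) :=
      (hgi.comp_smul hs0.ne').comp_sub_left x
    have i2 : Integrable (fun y => H (s • y)) := hHi.comp_smul hs0.ne'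
    have v1 : ∫ y, g (s • (x - y)) = G / n := by
      rw [integral_sub_left_eq_self (fun y => g (s • y)) volume x, Measure.integral_comp_smul]
      simp [hs2, abs_of_pos hn0, G, div_eq_inv_mul]
    have v2 : ∫ y, H (s • y) = B / n := by
      rw [Measure.integral_comp_smul]
      simp [hs2, abs_of_pos hn0, B, div_eq_inv_mul]
    calc _ ≤ ∫ y, 2 ^ α * (2 * (L + 6 / β) * g (s • (x - y)) + 6 / β * H (s • y)) := by
          refine integral_mono_of_nonneg (Filter.Eventually.of_forall fun y => ?_)
            (((i1.const_mul _).add (i2.const_mul _)).const_mul _)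
            (Filter.Eventually.of_forall fun y => ?_)
          · simp only [Pi.zero_apply]; positivity
          · by_cases hy0 : y = 0
            · have := hg0 (s • (x - y))
              have := hH0 (s • y)
              simp only [hy0, norm_zero, Real.log_zero, abs_zero, mul_zero]
              subst hy0
              positivity
            · have := aux_comb α β (s * ‖y‖) (s * ‖x - y‖) L _ hβ (by linarith)
                (mul_pos hs0 (norm_pos_iff.2 hy0)) (by positivity) hL (hy y hy0)
              simpa only [hg, hH, norm_smul, Real.norm_of_nonneg hs0.le] using this
      _ = 2 ^ α * (2 * (L + 6 / β) * G + 6 / β * B) / n := by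
          rw [integral_const_mul, integral_add (i1.const_mul _) (i2.const_mul _),
            integral_const_mul, integral_const_mul, v1, v2]
          ring
      _ ≤ D * (1 + L) / n := by
          rw [hD, mul_assoc (2 ^ α) _ (1 + L)]
          have h2α : (0:ℝ) ≤ 2 ^ α := by positivity
          refine div_le_div_of_nonneg_right (mul_le_mul_of_nonneg_left ?_ h2α) hn0.le
          have h1 : 0 ≤ 12 / β * G * L := by positivity
          have h2 : 0 ≤ 6 / β * B * L := by positivity
          have h3 : 12 / β * G = 2 * (6 / β) * G := by ring
          nlinarith
      _ = _ := by ring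
  have tri1 : ∀ y, s * ‖x‖ ≤ s * ‖y‖ + s * ‖x - y‖ := fun y => by
    rw [← mul_add]; gcongr
    have := norm_add_le y (x - y)
    simpa using this
  have tri2 : ∀ y, s * ‖y‖ ≤ s * ‖x‖ + s * ‖x - y‖ := fun y => by
    rw [← mul_add]; gcongr
    have := norm_sub_le x (x - y)
    simpa using this
  have ly : ∀ y : EuclideanSpace ℝ (Fin 2), y ≠ 0 →
      Real.log (s * ‖y‖) = Real.log s + Real.log ‖y‖ := fun y hy =>
    Real.log_mul hs0.ne' (norm_ne_zero_iff.2 hy)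
  have hX : 0 ≤ |Real.log ‖x‖| / n := by positivity
  have hN : 0 ≤ Real.log n / n := by positivity
  have h1n : 0 ≤ 1 / n := by positivity
  split_ifs with hx
  · rw [lt_div_iff₀ hs0] at hx
    refine (key (Real.log n) hlogn ?_).trans ?_
    · intro y hy
      have := aux_small β (s * ‖x‖) (s * ‖y‖) (s * ‖x - y‖) hβ hβ1 (by linarith)
        (mul_pos hs0 (norm_pos_iff.2 hy)) (by positivity) (tri2 y)
      rw [ly y hy, hlogs] at this
      have h5 := abs_sub_abs_le_abs_sub (Real.log ‖y‖) (-(Real.log n / 2))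
      rw [abs_neg, abs_of_nonneg (by positivity : 0 ≤ Real.log n / 2), sub_neg_eq_add,
        add_comm (Real.log ‖y‖)] at h5
      linarith
    · rw [add_div]
      nlinarith
  · rw [not_lt, div_le_iff₀ hs0] at hx
    have hx0 : x ≠ 0 := by rintro rfl; simp at hx; linarith
    refine (key |Real.log ‖x‖| (abs_nonneg _) ?_).trans ?_
    · intro y hy
      have := aux_big β (s * ‖x‖) (s * ‖y‖) (s * ‖x - y‖) hβ hβ1 (by linarith)
        (mul_pos hs0 (norm_pos_iff.2 hy)) (by positivity) (tri1 y) (tri2 y)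
      rw [ly y hy, ly x hx0, add_sub_add_left_eq_sub] at this
      have h5 := abs_sub_abs_le_abs_sub (Real.log ‖y‖) (Real.log ‖x‖)
      linarith
    · rw [add_div]
      nlinarith
end

section
/- For dimension d=2, α>2, and n≥1, there exists a constant C (depending only on α) such that for all x∈ℝ², ∫_{ℝ²} |log|x−y||·(1 ∧ |√n y|^{-α})·|log|y|| dy ≤ C·( 1/n + (log n)/n + |log|x||/n + (log n)|log|x||/n + (log|x|)²/n + (log n)²/n · 1_{|x|<1/√n} ). -/
open MeasureTheory Real

namespace LogConv

/-- Local singular kernel. -/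
noncomputable def kf (r : ℝ) : ℝ := (Set.Iio (1:ℝ)).indicator (fun r => r⁻¹) r

lemma kf_nonneg {r : ℝ} (hr : 0 ≤ r) : 0 ≤ kf r := by
  unfold kf
  rw [Set.indicator_apply]
  split_ifs <;> positivity

lemma kf_integrable : Integrable (fun z : EuclideanSpace ℝ (Fin 2) => kf ‖z‖) := by
  rw [integrable_fun_norm_addHaar (volume : Measure (EuclideanSpace ℝ (Fin 2))) (f := kf)]
  have h : IntegrableOn (fun _ : ℝ => (1:ℝ)) (Set.Ioo 0 1) := by simp
  have h2 : IntegrableOn ((Set.Iio (1:ℝ)).indicator (fun _ : ℝ => (1:ℝ))) (Set.Ioi 0) := by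
    rw [← integrable_indicator_iff measurableSet_Ioi, Set.indicator_indicator,
      integrable_indicator_iff (measurableSet_Ioi.inter measurableSet_Iio)]
    exact h
  refine h2.congr_fun ?_ measurableSet_Ioi
  intro r hr
  have hr : 0 < r := hr
  by_cases h1 : r < 1 <;> simp [kf, h1, hr.ne']

lemma logb_sq {r : ℝ} (hr : 0 < r) : log (1 + 1 / r) ^ 2 ≤ 4 * (1 + kf r) := by
  have ht : 0 < 1 / r := by positivity
  have h0 : 0 ≤ log (1 + 1 / r) := log_nonneg (by linarith)
  have h1 : log (1 + 1 / r) ≤ 2 * sqrt (1 / r) := by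
    have e : 1 + 1 / r ≤ (1 + sqrt (1 / r)) ^ 2 := by
      nlinarith [sq_sqrt ht.le, sqrt_nonneg (1 / r)]
    calc log (1 + 1 / r) ≤ log ((1 + sqrt (1 / r)) ^ 2) := log_le_log (by linarith) e
      _ = 2 * log (1 + sqrt (1 / r)) := by rw [log_pow]; norm_num
      _ ≤ 2 * sqrt (1 / r) := by
        have := log_le_sub_one_of_pos (x := 1 + sqrt (1 / r)) (by positivity)
        linarith
  have h2 : log (1 + 1 / r) ^ 2 ≤ 4 * (1 / r) := by
    have := pow_le_pow_left₀ h0 h1 2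
    rw [mul_pow, sq_sqrt ht.le] at this
    linarith
  have h3 : 1 / r ≤ 1 + kf r := by
    by_cases h : r < 1
    · simp [kf, h]
    · simp only [kf, Set.mem_Iio, h, not_false_eq_true, Set.indicator_of_notMem, add_zero]
      rw [div_le_one hr]; linarith
  linarith

lemma loga_sq {δ : ℝ} (hδ : 0 < δ) {r : ℝ} (hr : 0 ≤ r) :
    log (1 + r) ^ 2 ≤ 4 / δ ^ 2 * (1 + r) ^ δ := by
  have h0 : 0 ≤ log (1 + r) := log_nonneg (by linarith)
  have h := log_le_rpow_div (x := 1 + r) (by linarith) (half_pos hδ)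
  have := pow_le_pow_left₀ h0 h 2
  rw [div_pow, ← rpow_natCast ((1 + r) ^ (δ / 2)), ← rpow_mul (by linarith)] at this
  have e : δ / 2 * ((2:ℕ):ℝ) = δ := by push_cast; ring
  rw [e] at this
  calc _ ≤ _ := this
    _ = _ := by field_simp; ring

lemma min_bound {α : ℝ} (hα : 2 < α) {r : ℝ} (hr : 0 < r) :
    min 1 (r ^ (-α)) ≤ 2 ^ α * (1 + r) ^ (-α) := by
  rw [rpow_neg (by linarith : 0 ≤ 1 + r), rpow_neg hr.le, ← div_eq_mul_inv,
    ← div_rpow (by norm_num) (by linarith)]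
  rcases le_total r 1 with h | h
  · refine (min_le_left _ _).trans ?_
    apply one_le_rpow _ (by linarith)
    rw [le_div_iff₀ (by linarith)]; linarith
  · refine (min_le_right _ _).trans ?_
    rw [← inv_rpow hr.le]
    apply rpow_le_rpow (by positivity) _ (by linarith)
    rw [inv_eq_one_div, div_le_div_iff₀ hr (by linarith)]; linarith

lemma abs_log_le {r : ℝ} (hr : 0 < r) : |log r| ≤ log (1 + r) + log (1 + 1 / r) := by
  have h1 : log r ≤ log (1 + r) := log_le_log hr (by linarith)
  have h2 : -log r ≤ log (1 + 1 / r) := by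
    rw [← log_inv, ← one_div]
    exact log_le_log (by positivity) (by linarith)
  have h3 : 0 ≤ log (1 + r) := log_nonneg (by linarith)
  have h4 : 0 ≤ log (1 + 1 / r) := log_nonneg (by linarith [one_div_pos.2 hr])
  rw [abs_le]; constructor <;> linarith

/-- `ρ = |w|`, `t = |z|`, `r = |w - z|`. -/
lemma abs_log_ratio {ρ t r : ℝ} (hρ : 1 ≤ ρ) (ht : 0 ≤ t) (hr : 0 < r) (h1 : r ≤ ρ + t)
    (h2 : ρ ≤ r + t) : |log r - log ρ| ≤ log (1 + t) + log (1 + 1 / r) := by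
  have ha : 0 ≤ log (1 + t) := log_nonneg (by linarith)
  have hb : 0 ≤ log (1 + 1 / r) := log_nonneg (by linarith [one_div_pos.2 hr])
  have e1 : log r ≤ log ρ + log (1 + t) := by
    rw [← log_mul (by linarith) (by linarith)]
    apply log_le_log hr
    nlinarith
  have e2 : log ρ ≤ log r + (log (1 + t) + log (1 + 1 / r)) := by
    rw [← log_mul (by linarith) (by positivity), ← log_mul hr.ne' (by positivity)]
    apply log_le_log (by linarith)
    have : r * ((1 + t) * (1 + 1 / r)) = (1 + t) * (r + 1) := by field_simp
    rw [this]; nlinarith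
  rw [abs_le]; constructor <;> linarith

lemma weight_bound {α : ℝ} (hα : 2 < α) {t r : ℝ} (ht : 0 < t) (hr : 0 < r) :
    (1 + (log (1 + t) + log (1 + 1 / r))) * min 1 (t ^ (-α)) *
      (1 + (log (1 + t) + log (1 + 1 / t))) ≤
    (2 ^ α * (30 + 6 * (4 / (α / 2 - 1) ^ 2))) * (1 + t) ^ (-(α / 2 + 1)) + 12 * kf r + 12 * kf t := by
  have hδ : 0 < α / 2 - 1 := by linarith
  have hb1 := logb_sq hr
  have hb2 := logb_sq ht
  have ha := loga_sq hδ ht.le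
  have hm := min_bound hα ht
  have hm0 : 0 ≤ min 1 (t ^ (-α)) := le_min zero_le_one (by positivity)
  have hm1 : min 1 (t ^ (-α)) ≤ 1 := min_le_left _ _
  have k1 := kf_nonneg hr.le
  have k2 := kf_nonneg ht.le
  set m := min 1 (t ^ (-α))
  set a := log (1 + t)
  set b := log (1 + 1 / r)
  set c := log (1 + 1 / t)
  set D := 4 / (α / 2 - 1) ^ 2
  have hD : 0 ≤ D := by positivity
  have hq : 1 ≤ (1 + t) ^ (α / 2 - 1) := one_le_rpow (by linarith) hδ.le
  have hp : 0 ≤ (1 + t) ^ (-α) := by positivity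
  have key : (1 + (a + b)) * (1 + (a + c)) ≤
      (30 + 6 * D) * (1 + t) ^ (α / 2 - 1) + (12 * kf r + 12 * kf t) := by
    have : (1 + (a + b)) * (1 + (a + c)) ≤ 6 + 6 * a ^ 2 + 3 * b ^ 2 + 3 * c ^ 2 := by
      nlinarith [sq_nonneg (b - c), sq_nonneg (1 - a), sq_nonneg (1 - b), sq_nonneg (1 - c),
        sq_nonneg (a - b), sq_nonneg (a - c)]
    nlinarith
  have e : (1 + t) ^ (-α) * (1 + t) ^ (α / 2 - 1) = (1 + t) ^ (-(α / 2 + 1)) := by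
    rw [← rpow_add (by linarith)]; congr 1; ring
  calc (1 + (a + b)) * m * (1 + (a + c)) = m * ((1 + (a + b)) * (1 + (a + c))) := by ring
    _ ≤ m * ((30 + 6 * D) * (1 + t) ^ (α / 2 - 1) + (12 * kf r + 12 * kf t)) :=
        mul_le_mul_of_nonneg_left key hm0
    _ = m * ((30 + 6 * D) * (1 + t) ^ (α / 2 - 1)) + m * (12 * kf r + 12 * kf t) := by ring
    _ ≤ (2 ^ α * (1 + t) ^ (-α)) * ((30 + 6 * D) * (1 + t) ^ (α / 2 - 1))
        + 1 * (12 * kf r + 12 * kf t) := by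
        gcongr
    _ = (2 ^ α * (30 + 6 * D)) * ((1 + t) ^ (-α) * (1 + t) ^ (α / 2 - 1))
        + 12 * kf r + 12 * kf t := by ring
    _ = _ := by rw [e]

/-- Main estimate given a bound on the first logarithm. -/
lemma main {α : ℝ} (hα : 2 < α) {K I J : ℝ}
    (hK : K = 2 ^ α * (30 + 6 * (4 / (α / 2 - 1) ^ 2)))
    (hI : I = ∫ z : EuclideanSpace ℝ (Fin 2), (1 + ‖z‖) ^ (-(α / 2 + 1)))
    (hJ : J = ∫ z : EuclideanSpace ℝ (Fin 2), kf ‖z‖)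
    {n : ℝ} (hn : 1 ≤ n) (x : EuclideanSpace ℝ (Fin 2)) {A : ℝ} (hA : 0 ≤ A)
    (h : ∀ y : EuclideanSpace ℝ (Fin 2), y ≠ x → |log ‖x - y‖| ≤
      A + 1 + (log (1 + √n * ‖y‖) + log (1 + 1 / (√n * ‖x - y‖)))) :
    (∫ y : EuclideanSpace ℝ (Fin 2),
          |Real.log ‖x - y‖| * (min 1 ((Real.sqrt n * ‖y‖) ^ (-α))) * |Real.log ‖y‖|)
      ≤ (K * I + 24 * J) * ((1 + A) * (1 + log n / 2) / n) := by
  have hs : 0 < √n := sqrt_pos.2 (by linarith)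
  have hL : 0 ≤ log n := log_nonneg hn
  set w := √n • x with hw
  set G : EuclideanSpace ℝ (Fin 2) → ℝ := fun z =>
    (1 + A) * (1 + log n / 2) *
      (K * (1 + ‖z‖) ^ (-(α / 2 + 1)) + 12 * kf ‖w - z‖ + 12 * kf ‖z‖) with hG
  have i1 : Integrable (fun z : EuclideanSpace ℝ (Fin 2) => (1 + ‖z‖) ^ (-(α / 2 + 1))) := by
    apply integrable_one_add_norm
    rw [finrank_euclideanSpace_fin]; push_cast; linarith
  have i2 := kf_integrable
  have i3 : Integrable (fun z : EuclideanSpace ℝ (Fin 2) => kf ‖w - z‖) :=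
    i2.comp_sub_left w
  have j3 : ∫ z : EuclideanSpace ℝ (Fin 2), kf ‖w - z‖ = J := by
    rw [hJ]
    exact integral_sub_left_eq_self (fun z : EuclideanSpace ℝ (Fin 2) => kf ‖z‖) volume w
  have i4 : Integrable (fun z : EuclideanSpace ℝ (Fin 2) =>
      K * (1 + ‖z‖) ^ (-(α / 2 + 1)) + 12 * kf ‖w - z‖) :=
    (i1.const_mul K).add (i3.const_mul 12)
  have iG : Integrable G :=
    (((i1.const_mul K).add (i3.const_mul 12)).add (i2.const_mul 12)).const_mul _
  have jG : ∫ z, G z = (1 + A) * (1 + log n / 2) * (K * I + 24 * J) := by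
    simp only [hG]
    rw [integral_const_mul, integral_add i4 (i2.const_mul 12),
      integral_add (i1.const_mul K) (i3.const_mul 12), integral_const_mul, integral_const_mul,
      integral_const_mul, j3, ← hI, ← hJ]
    ring
  have iGs : Integrable (fun y => G (√n • y)) := iG.comp_smul hs.ne'
  have jGs : ∫ y, G (√n • y) = (K * I + 24 * J) * ((1 + A) * (1 + log n / 2) / n) := by
    rw [Measure.integral_comp_smul, jG, finrank_euclideanSpace_fin, sq_sqrt (by linarith),
      abs_of_nonneg (by positivity), smul_eq_mul]
    ring
  rw [← jGs]
  have hK0 : 0 ≤ K := by rw [hK]; positivity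
  refine integral_mono_of_nonneg (Filter.Eventually.of_forall fun y => ?_) iGs
    (Filter.Eventually.of_forall fun y => ?_)
  · have : 0 ≤ min 1 ((√n * ‖y‖) ^ (-α)) := le_min zero_le_one (by positivity)
    show 0 ≤ _
    positivity
  have hG0 : 0 ≤ G (√n • y) := by
    have := kf_nonneg (norm_nonneg (√n • y))
    have := kf_nonneg (norm_nonneg (w - √n • y))
    simp only [hG]
    positivity
  show _ ≤ G (√n • y)
  by_cases hy0 : y = 0
  · simpa [hy0] using hG0
  by_cases hyx : y = x
  · subst hyx; simpa using hG0
  have hyn : 0 < ‖y‖ := norm_pos_iff.2 hy0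
  have hxy : 0 < ‖x - y‖ := norm_pos_iff.2 (sub_ne_zero.2 (Ne.symm hyx))
  have ht : 0 < √n * ‖y‖ := by positivity
  have hr : 0 < √n * ‖x - y‖ := by positivity
  have n1 : ‖√n • y‖ = √n * ‖y‖ := by rw [norm_smul, norm_of_nonneg hs.le]
  have n2 : ‖w - √n • y‖ = √n * ‖x - y‖ := by
    rw [hw, ← smul_sub, norm_smul, norm_of_nonneg hs.le]
  simp only [hG]
  rw [n1, n2, hK]
  have hwt := weight_bound hα ht hr
  have hx1 := h y hyx
  have hy1 : |log ‖y‖| ≤ log n / 2 + (log (1 + √n * ‖y‖) + log (1 + 1 / (√n * ‖y‖))) := by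
    have e : log ‖y‖ = log (√n * ‖y‖) - log n / 2 := by
      rw [log_mul hs.ne' hyn.ne', log_sqrt (by linarith)]; ring
    rw [e]
    have := abs_log_le ht
    have h2 := abs_sub (log (√n * ‖y‖)) (log n / 2)
    rw [abs_of_nonneg (by linarith : 0 ≤ log n / 2)] at h2
    linarith
  have hm0 : 0 ≤ min 1 ((√n * ‖y‖) ^ (-α)) := le_min zero_le_one (by positivity)
  have ha : 0 ≤ log (1 + √n * ‖y‖) := log_nonneg (by linarith)
  have hb : 0 ≤ log (1 + 1 / (√n * ‖y‖)) := log_nonneg (by linarith [one_div_pos.2 ht])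
  have hc : 0 ≤ log (1 + 1 / (√n * ‖x - y‖)) := log_nonneg (by linarith [one_div_pos.2 hr])
  refine le_trans ?_ (mul_le_mul_of_nonneg_left hwt
    (by positivity : 0 ≤ (1 + A) * (1 + log n / 2)))
  set m := min 1 ((√n * ‖y‖) ^ (-α))
  set a := log (1 + √n * ‖y‖)
  set b := log (1 + 1 / (√n * ‖y‖))
  set c := log (1 + 1 / (√n * ‖x - y‖))
  have f1 : |log ‖x - y‖| ≤ (1 + A) * (1 + (a + c)) := by nlinarith [mul_nonneg hA (add_nonneg ha hc)]
  have f2 : |log ‖y‖| ≤ (1 + log n / 2) * (1 + (a + b)) := by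
    nlinarith [mul_nonneg hL (add_nonneg ha hb)]
  calc |log ‖x - y‖| * m * |log ‖y‖|
      ≤ ((1 + A) * (1 + (a + c))) * m * ((1 + log n / 2) * (1 + (a + b))) := by gcongr
    _ = _ := by ring

end LogConv

open LogConv in
/-- For `d = 2`, `α > 2`, `n ≥ 1`: the logarithmic double-convolution estimate
`∫_{ℝ²} |log|x-y|| (1 ∧ |√n y|^{-α}) |log|y|| dy ≤ C (1/n + (log n)/n + |log|x||/n
+ (log n)|log|x||/n + (log|x|)²/n + (log n)²/n · 1_{|x| < 1/√n})`. -/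
theorem stmt3 (α : ℝ) (hα : 2 < α) :
    ∃ C : ℝ, 0 < C ∧ ∀ n : ℝ, 1 ≤ n → ∀ x : EuclideanSpace ℝ (Fin 2),
      (∫ y : EuclideanSpace ℝ (Fin 2),
          |Real.log ‖x - y‖| * (min 1 ((Real.sqrt n * ‖y‖) ^ (-α))) * |Real.log ‖y‖|)
        ≤ C * (1 / n + Real.log n / n + |Real.log ‖x‖| / n
            + Real.log n * |Real.log ‖x‖| / n + (Real.log ‖x‖) ^ 2 / n
            + (if ‖x‖ < 1 / Real.sqrt n then (Real.log n) ^ 2 / n else 0)) := by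
  obtain ⟨K, hK⟩ : ∃ K : ℝ, K = 2 ^ α * (30 + 6 * (4 / (α / 2 - 1) ^ 2)) := ⟨_, rfl⟩
  obtain ⟨I, hI⟩ : ∃ I : ℝ, I = ∫ z : EuclideanSpace ℝ (Fin 2), (1 + ‖z‖) ^ (-(α / 2 + 1)) :=
    ⟨_, rfl⟩
  obtain ⟨J, hJ⟩ : ∃ J : ℝ, J = ∫ z : EuclideanSpace ℝ (Fin 2), kf ‖z‖ := ⟨_, rfl⟩
  have hK0 : 0 ≤ K := by rw [hK]; positivity
  have hI0 : 0 ≤ I := by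
    rw [hI]; exact integral_nonneg fun z => by positivity
  have hJ0 : 0 ≤ J := by
    rw [hJ]; exact integral_nonneg fun z => kf_nonneg (norm_nonneg z)
  have hC : 0 ≤ K * I + 24 * J := by positivity
  refine ⟨K * I + 24 * J + 1, by linarith, fun n hn x => ?_⟩
  have hn0 : 0 < n := by linarith
  have hs : 0 < √n := sqrt_pos.2 hn0
  have hL : 0 ≤ log n := log_nonneg hn
  have elog : ∀ u : EuclideanSpace ℝ (Fin 2), u ≠ 0 → log ‖u‖ = log (√n * ‖u‖) - log n / 2 := by
    intro u hu
    rw [log_mul hs.ne' (norm_ne_zero_iff.2 hu), log_sqrt hn0.le]; ring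
  have fin : ∀ A : ℝ, 0 ≤ A → ∀ R : ℝ, (1 + A) * (1 + log n / 2) ≤ R →
      (K * I + 24 * J) * ((1 + A) * (1 + log n / 2) / n) ≤ (K * I + 24 * J + 1) * (R / n) := by
    intro A hA R hR
    have : 0 ≤ (1 + A) * (1 + log n / 2) := by positivity
    have h1 : (1 + A) * (1 + log n / 2) / n ≤ R / n := by gcongr
    have h2 : 0 ≤ (1 + A) * (1 + log n / 2) / n := by positivity
    exact mul_le_mul (by linarith) h1 h2 (by linarith)
  by_cases hx : ‖x‖ < 1 / √n
  · rw [if_pos hx]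
    have hx' : √n * ‖x‖ < 1 := by rw [lt_div_iff₀ hs] at hx; linarith
    refine (main hα hK hI hJ hn x (A := log n / 2) (by linarith) ?_).trans ?_
    · intro y hy
      have hne : x - y ≠ 0 := sub_ne_zero.2 (Ne.symm hy)
      have hr : 0 < √n * ‖x - y‖ := mul_pos hs (norm_pos_iff.2 hne)
      have ht : 0 ≤ √n * ‖y‖ := by positivity
      rw [elog _ hne]
      have h1 := abs_log_le hr
      have h2 := abs_sub (log (√n * ‖x - y‖)) (log n / 2)
      rw [abs_of_nonneg (by linarith : 0 ≤ log n / 2)] at h2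
      have h3 : log (1 + √n * ‖x - y‖) ≤ 1 + log (1 + √n * ‖y‖) := by
        have : log (1 + √n * ‖x - y‖) ≤ log (2 * (1 + √n * ‖y‖)) := by
          apply log_le_log (by linarith)
          have := mul_le_mul_of_nonneg_left (norm_sub_le x y) hs.le
          linarith
        rw [log_mul (by norm_num) (by linarith)] at this
        have := log_two_lt_d9
        linarith
      linarith
    · have := fin (log n / 2) (by linarith) (1 + log n + |log ‖x‖| + log n * |log ‖x‖| +
        (log ‖x‖) ^ 2 + (log n) ^ 2) (by
          have := abs_nonneg (log ‖x‖)
          have := mul_nonneg hL this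
          nlinarith [sq_nonneg (log ‖x‖), sq_nonneg (log n)])
      refine this.trans (le_of_eq ?_)
      ring
  · rw [if_neg hx]
    have hx' : 1 ≤ √n * ‖x‖ := by
      rw [not_lt, div_le_iff₀ hs] at hx; linarith
    have hx0 : x ≠ 0 := by
      rintro rfl
      norm_num at hx'
    refine (main hα hK hI hJ hn x (A := |log ‖x‖|) (abs_nonneg _) ?_).trans ?_
    · intro y hy
      have hne : x - y ≠ 0 := sub_ne_zero.2 (Ne.symm hy)
      have hr : 0 < √n * ‖x - y‖ := mul_pos hs (norm_pos_iff.2 hne)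
      have ht : 0 ≤ √n * ‖y‖ := by positivity
      have h1 := abs_log_ratio hx' ht hr
        (by have := mul_le_mul_of_nonneg_left (norm_sub_le x y) hs.le; linarith)
        (by
          have h5 : ‖x‖ ≤ ‖x - y‖ + ‖y‖ := by simpa using norm_add_le (x - y) y
          have := mul_le_mul_of_nonneg_left h5 hs.le; linarith)
      have e : log ‖x - y‖ = log ‖x‖ + (log (√n * ‖x - y‖) - log (√n * ‖x‖)) := by
        rw [elog _ hne, elog _ hx0]; ring
      have h2 := abs_add_le (log ‖x‖) (log (√n * ‖x - y‖) - log (√n * ‖x‖))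
      rw [← e] at h2
      linarith
    · have := fin |log ‖x‖| (abs_nonneg _) (1 + log n + |log ‖x‖| + log n * |log ‖x‖| +
        (log ‖x‖) ^ 2) (by
          have := abs_nonneg (log ‖x‖)
          have := mul_nonneg hL this
          nlinarith [sq_nonneg (log ‖x‖)])
      refine this.trans (le_of_eq ?_)
      ring
end
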